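/- arXiv:1712.07554 — 2 statements merged into one kernel-verified Lean document; each statement's English description precedes it below -/
import Mathlib

section
/- There are no nonnegative integers $a,b,c,d$ such that the set of rational numbers $\{d+1,\; c+d+2,\; b+c+d+3,\; 2b+c+d+4,\; a+b+c+d+4,\; 2b+2c+d+5,\; a+2b+c+d+5,\; a+2b+\tfrac{3}{2}c+d+\tfrac{11}{2},\; a+2b+2c+d+6,\; 2a+2b+c+d+6,\; a+3b+2c+d+7,\; 2a+2b+2c+d+7,\; 2a+3b+2c+d+8,\; 2a+4b+2c+d+9,\; 2a+4b+3c+d+10\}$ equals $\{1,2,\dots,15\}$. -/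
theorem stmt3 :
    ¬ ∃ a b c d : ℤ, 0 ≤ a ∧ 0 ≤ b ∧ 0 ≤ c ∧ 0 ≤ d ∧
      ({(d:ℚ)+1, (c:ℚ)+d+2, (b:ℚ)+c+d+3, 2*(b:ℚ)+c+d+4, (a:ℚ)+b+c+d+4, 2*(b:ℚ)+2*c+d+5, (a:ℚ)+2*b+c+d+5, (a:ℚ)+2*b+(3/2)*c+d+11/2, (a:ℚ)+2*b+2*c+d+6, 2*(a:ℚ)+2*b+c+d+6, (a:ℚ)+3*b+2*c+d+7, 2*(a:ℚ)+2*b+2*c+d+7, 2*(a:ℚ)+3*b+2*c+d+8, 2*(a:ℚ)+4*b+2*c+d+9, 2*(a:ℚ)+4*b+3*c+d+10} : Set ℚ) = {1, 2, 3, 4, 5, 6, 7, 8, 9, 10, 11, 12, 13, 14, 15} := by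
  rintro ⟨a, b, c, d, ha, hb, hc, hd, h⟩
  have ha' : (0:ℚ) ≤ a := by exact_mod_cast ha
  have hb' : (0:ℚ) ≤ b := by exact_mod_cast hb
  have hc' : (0:ℚ) ≤ c := by exact_mod_cast hc
  have hd' : (0:ℚ) ≤ d := by exact_mod_cast hd
  rw [Set.ext_iff] at h
  simp only [Set.mem_insert_iff, Set.mem_singleton_iff] at h
  -- the value 1 forces d = 0
  have h1 : (d:ℚ) = 0 := by
    have := (h 1).2 (by simp)
    rcases this with h | h | h | h | h | h | h | h | h | h | h | h | h | h | h <;> linarith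
  -- the value 2 forces c = 0
  have h2 : (c:ℚ) = 0 := by
    have := (h 2).2 (by simp)
    rcases this with h | h | h | h | h | h | h | h | h | h | h | h | h | h | h <;> linarith
  -- so the eighth element is not an integer
  have h3 := (h ((a:ℚ)+2*b+(3/2)*c+d+11/2)).1 (by simp)
  have key : ∀ n : ℤ, (a:ℚ)+2*b+(3/2)*c+d+11/2 ≠ n := by
    intro n hn
    have h4 : (2:ℚ)*a+4*b+11 = 2*n := by linarith
    have h5 : 2*a+4*b+11 = 2*n := by exact_mod_cast h4
    omega
  rcases h3 with h | h | h | h | h | h | h | h | h | h | h | h | h | h | h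
  · exact key 1 (by rw [h]; norm_num)
  · exact key 2 (by rw [h]; norm_num)
  · exact key 3 (by rw [h]; norm_num)
  · exact key 4 (by rw [h]; norm_num)
  · exact key 5 (by rw [h]; norm_num)
  · exact key 6 (by rw [h]; norm_num)
  · exact key 7 (by rw [h]; norm_num)
  · exact key 8 (by rw [h]; norm_num)
  · exact key 9 (by rw [h]; norm_num)
  · exact key 10 (by rw [h]; norm_num)
  · exact key 11 (by rw [h]; norm_num)
  · exact key 12 (by rw [h]; norm_num)
  · exact key 13 (by rw [h]; norm_num)
  · exact key 14 (by rw [h]; norm_num)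
  · exact key 15 (by rw [h]; norm_num)
end

section
/- Suppose $a,b,c,d$ are integers with $b \geq 0$ (all others arbitrary, but required so that all listed values are rationals). Then the set of twenty rational numbers $\{\tfrac{1}{2}a+b+\tfrac{3}{4}c+\tfrac{1}{2}d+\tfrac{11}{4},\; a+b+\tfrac{1}{2}c+\tfrac{5}{2},\; b+\tfrac{1}{2}c+\tfrac{3}{2},\; \tfrac{2}{3}a+b+\tfrac{2}{3}c+\tfrac{1}{3}d+\tfrac{8}{3},\; \tfrac{1}{3}a+b+\tfrac{2}{3}c+\tfrac{1}{3}d+\tfrac{7}{3},\; \tfrac{1}{2}a+b+c+\tfrac{1}{2}d+3,\; \tfrac{1}{2}a+b+\tfrac{1}{2}c+2,\; a+b+c+3,\; b+c+2,\; b+c+d+3,\; a+b+c+d+4,\; \tfrac{1}{2}a+b+\tfrac{1}{2}c+\tfrac{1}{2}d+\tfrac{5}{2},\; a+b+2,\; b+1,\; \tfrac{1}{2}a+b+\tfrac{3}{4}c+\tfrac{1}{4}d+\tfrac{5}{2},\; \tfrac{1}{2}a+b+\tfrac{1}{2}c+\tfrac{1}{4}d+\tfrac{9}{4},\; a+b+c+\tfrac{1}{2}d+\tfrac{7}{2},\;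 b+c+\tfrac{1}{2}d+\tfrac{5}{2},\; a+b+\tfrac{1}{2}c+\tfrac{1}{2}d+3,\; b+\tfrac{1}{2}c+\tfrac{1}{2}d+2\}$ never equals $\{1,2,\dots,20\}$, for any choice of integers $a,c,d$ with $a,c,d$ such that all values are in $\mathbb{Q}$ and $a,c,d \geq 0$ where required ($a,c,d \geq 0$). -/
theorem stmt5 :
    ¬ ∃ a b c d : ℤ, 0 ≤ a ∧ 0 ≤ b ∧ 0 ≤ c ∧ 0 ≤ d ∧
      ({(1/2)*(a:ℚ)+b+(3/4)*c+(1/2)*d+11/4, (a:ℚ)+b+(1/2)*c+5/2, (b:ℚ)+(1/2)*c+3/2, (2/3)*(a:ℚ)+b+(2/3)*c+(1/3)*d+8/3, (1/3)*(a:ℚ)+b+(2/3)*c+(1/3)*d+7/3, (1/2)*(a:ℚ)+b+c+(1/2)*d+3, (1/2)*(a:ℚ)+b+(1/2)*c+2, (a:ℚ)+b+c+3, (b:ℚ)+c+2, (b:ℚ)+c+d+3, (a:ℚ)+b+c+d+4, (1/2)*(a:ℚ)+b+(1/2)*c+(1/2)*d+5/2, (a:ℚ)+b+2, (b:ℚ)+1,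 (1/2)*(a:ℚ)+b+(3/4)*c+(1/4)*d+5/2, (1/2)*(a:ℚ)+b+(1/2)*c+(1/4)*d+9/4, (a:ℚ)+b+c+(1/2)*d+7/2, (b:ℚ)+c+(1/2)*d+5/2, (a:ℚ)+b+(1/2)*c+(1/2)*d+3, (b:ℚ)+(1/2)*c+(1/2)*d+2} : Set ℚ) = {1, 2, 3, 4, 5, 6, 7, 8, 9, 10, 11, 12, 13, 14, 15, 16, 17, 18, 19, 20} := by
  rintro ⟨a, b, c, d, ha, hb, hc, hd, h⟩
  have ha' : (0:ℚ) ≤ a := by exact_mod_cast ha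
  have hb' : (0:ℚ) ≤ b := by exact_mod_cast hb
  have hc' : (0:ℚ) ≤ c := by exact_mod_cast hc
  have hd' : (0:ℚ) ≤ d := by exact_mod_cast hd
  -- every element of the right-hand side is an integer between 1 and 20
  have key : ∀ x : ℚ, x ∈ ({1, 2, 3, 4, 5, 6, 7, 8, 9, 10, 11, 12, 13, 14, 15, 16, 17, 18, 19, 20} : Set ℚ) →
      ∃ n : ℤ, x = n ∧ 1 ≤ n ∧ n ≤ 20 := by
    intro x hx
    simp only [Set.mem_insert_iff, Set.mem_singleton_iff] at hx
    rcases hx with h | h | h | h | h | h | h | h | h | h | h | h | h | h | h | h | h | h | h | h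
    exacts [⟨1, by simp [h]⟩, ⟨2, by simp [h]⟩, ⟨3, by simp [h]⟩, ⟨4, by simp [h]⟩,
      ⟨5, by simp [h]⟩, ⟨6, by simp [h]⟩, ⟨7, by simp [h]⟩, ⟨8, by simp [h]⟩, ⟨9, by simp [h]⟩,
      ⟨10, by simp [h]⟩, ⟨11, by simp [h]⟩, ⟨12, by simp [h]⟩, ⟨13, by simp [h]⟩,
      ⟨14, by simp [h]⟩, ⟨15, by simp [h]⟩, ⟨16, by simp [h]⟩, ⟨17, by simp [h]⟩,
      ⟨18, by simp [h]⟩, ⟨19, by simp [h]⟩, ⟨20, by simp [h]⟩]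
  -- smallest value: b + 1 = 1
  have hmin : (b:ℚ) + 1 ≤ 1 := by
    have h1 : (1:ℚ) ∈ ({1, 2, 3, 4, 5, 6, 7, 8, 9, 10, 11, 12, 13, 14, 15, 16, 17, 18, 19, 20} : Set ℚ) := by
      simp only [Set.mem_insert_iff, true_or]
    rw [← h] at h1
    simp only [Set.mem_insert_iff, Set.mem_singleton_iff] at h1
    rcases h1 with h | h | h | h | h | h | h | h | h | h | h | h | h | h | h | h | h | h | h | h <;>
      linarith
  -- largest value: a + b + c + d + 4 = 20
  have hmax : (20:ℚ) ≤ a + b + c + d + 4 := by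
    have h1 : (20:ℚ) ∈ ({1, 2, 3, 4, 5, 6, 7, 8, 9, 10, 11, 12, 13, 14, 15, 16, 17, 18, 19, 20} : Set ℚ) := by
      simp only [Set.mem_insert_iff, Set.mem_singleton_iff, or_true]
    rw [← h] at h1
    simp only [Set.mem_insert_iff, Set.mem_singleton_iff] at h1
    rcases h1 with h | h | h | h | h | h | h | h | h | h | h | h | h | h | h | h | h | h | h | h <;>
      linarith
  have hb1 : b + 1 ≤ 1 := by exact_mod_cast hmin
  have hm1 : 20 ≤ a + b + c + d + 4 := by exact_mod_cast hmax
  obtain ⟨n, hn, -, hn2⟩ := key ((a:ℚ)+b+c+d+4) (by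
    rw [← h]; simp only [Set.mem_insert_iff, true_or, or_true])
  obtain ⟨p, hp, -, -⟩ := key ((b:ℚ)+(1/2)*c+3/2) (by
    rw [← h]; simp only [Set.mem_insert_iff, true_or, or_true])
  obtain ⟨q, hq, -, -⟩ := key ((1/2)*(a:ℚ)+b+(1/2)*c+2) (by
    rw [← h]; simp only [Set.mem_insert_iff, true_or, or_true])
  obtain ⟨r, hr, -, -⟩ := key ((b:ℚ)+c+(1/2)*d+5/2) (by
    rw [← h]; simp only [Set.mem_insert_iff, true_or, or_true])
  have en : a + b + c + d + 4 = n := by exact_mod_cast hn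
  have ep : 2 * b + c + 3 = 2 * p := by
    have : (2:ℚ) * b + c + 3 = 2 * p := by linarith
    exact_mod_cast this
  have eq : a + 2 * b + c + 4 = 2 * q := by
    have : (a:ℚ) + 2 * b + c + 4 = 2 * q := by linarith
    exact_mod_cast this
  have er : 2 * b + 2 * c + d + 5 = 2 * r := by
    have : (2:ℚ) * b + 2 * c + d + 5 = 2 * r := by linarith
    exact_mod_cast this
  -- so a, c, d are all odd while a + c + d = 16
  omega
end
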